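/- Let X = (X_1, ..., X_M) be a centered jointly Gaussian random vector (i.e. its law is the multivariate Gaussian measure on R^M with mean zero and covariance matrix d, d_{kj} = E[X_k X_j]). For a real constant c define Q_1(c,X) = c * sum_{k=1}^M (X_k^2 - d_{kk}) and Q_2(c,X) = 2 c^2 * sum_{k,j=1}^M X_k X_j d_{kj}. Suppose Q_1(c,X) is not almost surely zero, fix alpha >= 0 and beta > 0, and assume Q_2(c,X) <= alpha * Q_1(c,X) + beta almost surely. Then for all z > 0: P(Q_1(c,X) >= z) <= exp(-z/alpha) * (1 + alpha*z/beta)^{beta/alpha^2}, and P(Q_1(c,X) <= -z) <= exp(z/alpha) * (1 - alpha*z/beta)^{beta/alpha^2} * 1_{[0, beta/alpha]}(z). -/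

import Mathlib

open MeasureTheory ProbabilityTheory

open Matrix in
/-- The real spectral theorem, with an explicit orthogonal change of basis. -/
lemma exists_orthogonal_diagonalization {n : Type*} [Fintype n] [DecidableEq n]
    {A : Matrix n n ℝ} (hA : A.IsSymm) :
    ∃ (U : Matrix n n ℝ) (l : n → ℝ), U * Uᵀ = 1 ∧ Uᵀ * U = 1 ∧ Uᵀ * A * U = diagonal l := by
  have hH : A.IsHermitian := by
    rw [Matrix.IsHermitian, conjTranspose_eq_transpose_of_trivial]; exact hA
  refine ⟨hH.eigenvectorUnitary, hH.eigenvalues, ?_, ?_, ?_⟩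
  · have := Unitary.coe_mul_star_self hH.eigenvectorUnitary
    rwa [Unitary.coe_star, star_eq_conjTranspose, conjTranspose_eq_transpose_of_trivial] at this
  · have := Unitary.coe_star_mul_self hH.eigenvectorUnitary
    rwa [star_eq_conjTranspose, conjTranspose_eq_transpose_of_trivial] at this
  · have := hH.conjStarAlgAut_star_eigenvectorUnitary
    rw [Unitary.conjStarAlgAut_apply] at this
    simpa [star_eq_conjTranspose, conjTranspose_eq_transpose_of_trivial] using! this

/-- A random vector all of whose linear combinations are Gaussian has a Gaussian law. -/
lemma hasGaussianLaw_of_forall_sum_mul {Ω ι : Type*} [MeasurableSpace Ω] [Fintype ι]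
    {P : Measure Ω} {X : ι → Ω → ℝ} (hX : ∀ i, Measurable (X i))
    (h : ∀ c : ι → ℝ, ∃ (m : ℝ) (v : NNReal),
      P.map (fun ω => ∑ i, c i * X i ω) = gaussianReal m v) :
    HasGaussianLaw (fun ω i => X i ω) P where
  isGaussian_map := by
    classical
    refine isGaussian_of_map_eq_gaussianReal fun L => ?_
    obtain ⟨m, v, hv⟩ := h fun i => L (Pi.single i 1)
    refine ⟨m, v, ?_⟩
    rw [← hv, Measure.map_map (by fun_prop) (by fun_prop)]
    congr 1
    ext ω
    rw [Function.comp_apply]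
    conv_lhs => rw [← Finset.univ_sum_single (fun i => X i ω), map_sum]
    refine Finset.sum_congr rfl fun i _ => ?_
    rw [← mul_one (X i ω), ← smul_eq_mul (X i ω), Pi.single_smul, map_smul]
    simp [mul_comm]

/-- A nondegenerate centered Gaussian charges every neighbourhood; a degenerate one charges every
neighbourhood of its mean. -/
lemma gaussianReal_ball_pos {v : NNReal} {y ε : ℝ} (hε : 0 < ε) (hy : v = 0 → y = 0) :
    0 < gaussianReal 0 v (Metric.ball y ε) := by
  rw [pos_iff_ne_zero]
  by_cases hv : v = 0
  · subst hv
    rw [gaussianReal_zero_var, hy rfl, Measure.dirac_apply' _ Metric.isOpen_ball.measurableSet]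
    simp [hε]
  · intro h
    exact (Metric.measure_ball_pos volume y hε).ne' (gaussianReal_absolutelyContinuous' 0 hv h)

lemma gaussianPDFReal_mul_exp_sq {v : NNReal} {s : ℝ} (hv : v ≠ 0) (x : ℝ) :
    gaussianPDFReal 0 v x * Real.exp (s * x ^ 2) =
      (√(2 * Real.pi * v))⁻¹ * Real.exp (-((1 - 2 * s * v) / (2 * v)) * x ^ 2) := by
  have : (v : ℝ) ≠ 0 := by exact_mod_cast hv
  rw [gaussianPDFReal, mul_assoc, ← Real.exp_add]
  congr 2
  field_simp
  ring

lemma integrable_exp_sq_gaussianReal {v : NNReal} {s : ℝ} (hs : 2 * s * v < 1) :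
    Integrable (fun x => Real.exp (s * x ^ 2)) (gaussianReal 0 v) := by
  by_cases hv : v = 0
  · subst hv
    rw [gaussianReal_zero_var]
    exact integrable_dirac (by simp)
  · have hv0 : (0 : ℝ) < v := by positivity
    rw [gaussianReal_of_var_ne_zero _ hv, integrable_withDensity_iff_integrable_smul'
      (measurable_gaussianPDF 0 v) (ae_of_all _ fun x => gaussianPDF_lt_top)]
    simp only [toReal_gaussianPDF, smul_eq_mul, gaussianPDFReal_mul_exp_sq hv]
    exact (integrable_exp_neg_mul_sq (div_pos (by linarith) (by positivity))).const_mul _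

lemma integral_exp_sq_gaussianReal {v : NNReal} {s : ℝ} (hs : 2 * s * v < 1) :
    ∫ x, Real.exp (s * x ^ 2) ∂(gaussianReal 0 v) = (√(1 - 2 * s * v))⁻¹ := by
  by_cases hv : v = 0
  · subst hv
    simp [gaussianReal_zero_var]
  · have hv0 : (0 : ℝ) < v := by positivity
    have hs0 : 0 < 1 - 2 * s * v := by linarith
    rw [integral_gaussianReal_eq_integral_smul hv]
    simp only [smul_eq_mul, gaussianPDFReal_mul_exp_sq hv]
    rw [integral_const_mul, integral_gaussian, ← Real.sqrt_inv, ← Real.sqrt_inv,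
      ← Real.sqrt_mul (by positivity)]
    congr 1
    field_simp

lemma mul_lt_one_of_lt_one_of_mem_unitInterval {r t : ℝ} (hr0 : 0 ≤ r) (hr1 : r ≤ 1)
    (ht : t < 1) : t * r < 1 := by
  rcases le_total t 0 with h | h
  · exact (mul_nonpos_of_nonpos_of_nonneg h hr0).trans_lt one_pos
  · exact (mul_le_of_le_one_right h hr1).trans_lt ht

/-- The Laplace transform of a centered chi-square variable is dominated by that of a
gamma variable with larger scale. -/
lemma exp_mul_inv_sqrt_le {r t : ℝ} (hr0 : 0 ≤ r) (hr1 : r ≤ 1) (ht : t < 1) :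
    Real.exp (-(t * r / 2)) * (√(1 - t * r))⁻¹ ≤
      Real.exp (r * ((-t - Real.log (1 - t)) / 2)) := by
  have h1 : 0 < 1 - t := by linarith
  have h2 : 0 < 1 - t * r := sub_pos.2 (mul_lt_one_of_lt_one_of_mem_unitInterval hr0 hr1 ht)
  have hB : r * Real.log (1 - t) ≤ Real.log (1 - t * r) := by
    have := rpow_one_add_le_one_add_mul_self (s := -t) (by linarith) hr0 hr1
    rw [← Real.log_rpow h1]
    rw [← sub_eq_add_neg, mul_neg, ← sub_eq_add_neg, mul_comm] at this
    exact Real.log_le_log (Real.rpow_pos_of_pos h1 _) this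
  rw [← Real.exp_log h2, ← Real.exp_half, ← Real.exp_neg, ← Real.exp_add, Real.exp_le_exp]
  linarith

section IndependentGaussian

variable {Ω ι : Type*} [MeasurableSpace Ω] [Fintype ι] {P : Measure Ω} {Y : ι → Ω → ℝ}
  {v : ι → NNReal}

/-- A random vector with independent centered Gaussian coordinates comes arbitrarily close to
any point of its support. -/
lemma exists_forall_dist_lt_of_ae (hY : ∀ i, Measurable (Y i)) (hind : iIndepFun Y P)
    (hlaw : ∀ i, P.map (Y i) = gaussianReal 0 (v i)) {p : Ω → Prop} (hp : ∀ᵐ ω ∂P, p ω)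
    {y : ι → ℝ} (hy : ∀ i, v i = 0 → y i = 0) {ε : ℝ} (hε : 0 < ε) :
    ∃ ω, p ω ∧ ∀ i, dist (Y i ω) (y i) < ε := by
  have hpos : P (⋂ i, Y i ⁻¹' Metric.ball (y i) ε) ≠ 0 := by
    rw [hind.meas_iInter fun i => ⟨_, Metric.isOpen_ball.measurableSet, rfl⟩,
      Finset.prod_ne_zero_iff]
    intro i _
    rw [← Measure.map_apply (hY i) Metric.isOpen_ball.measurableSet, hlaw i]
    exact (gaussianReal_ball_pos hε (hy i)).ne'
  have hfreq : ∃ᵐ ω ∂P, ω ∈ ⋂ i, Y i ⁻¹' Metric.ball (y i) ε := by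
    rwa [frequently_ae_mem_iff]
  obtain ⟨ω, hω, hpω⟩ := (hfreq.and_eventually hp).exists
  exact ⟨ω, hpω, by simpa using hω⟩

/-- An almost sure weak inequality between continuous functions of a vector with independent
centered Gaussian coordinates holds on the support. -/
lemma le_of_ae_le_comp (hY : ∀ i, Measurable (Y i)) (hind : iIndepFun Y P)
    (hlaw : ∀ i, P.map (Y i) = gaussianReal 0 (v i)) {F : (ι → ℝ) → ℝ} (hF : Continuous F)
    {b : ℝ} (hp : ∀ᵐ ω ∂P, F (fun i => Y i ω) ≤ b)
    {y : ι → ℝ} (hy : ∀ i, v i = 0 → y i = 0) : F y ≤ b := by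
  have hcl : IsClosed {x | F x ≤ b} := isClosed_le hF continuous_const
  change y ∈ {x | F x ≤ b}
  rw [← hcl.closure_eq, Metric.mem_closure_iff]
  intro ε hε
  obtain ⟨ω, hω, hd⟩ := exists_forall_dist_lt_of_ae hY hind hlaw hp hy hε
  exact ⟨_, hω, by rw [dist_comm]; exact (dist_pi_lt_iff hε).2 hd⟩

/-- Laplace transform bound for a weighted sum of centered chi-square variables. -/
lemma mgf_sum_sq_sub_le (hY : ∀ i, Measurable (Y i)) (hind : iIndepFun Y P)
    (hlaw : ∀ i, P.map (Y i) = gaussianReal 0 (v i)) {c α β t : ℝ} (hα : 0 < α) (hc : 0 ≤ c)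
    (hv : ∀ i, 2 * (c * v i) ≤ α) (hβ : α * (c * ∑ i, (v i : ℝ)) ≤ β) (ht : t < 1) :
    Integrable (fun ω => Real.exp (t / α * (c * ∑ i, (Y i ω ^ 2 - v i)))) P ∧
      mgf (fun ω => c * ∑ i, (Y i ω ^ 2 - v i)) P (t / α) ≤
        Real.exp (β / α ^ 2 * (-t - Real.log (1 - t))) := by
  set Z : ι → Ω → ℝ := fun i ω => c * (Y i ω ^ 2 - v i) with hZ
  have hZm : ∀ i, Measurable (Z i) := fun i => by have := hY i; fun_prop
  have hZind : iIndepFun Z P :=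
    hind.comp (fun i x => c * (x ^ 2 - v i)) (fun i => by fun_prop)
  have hsum : (fun ω => c * ∑ i, (Y i ω ^ 2 - v i)) = ∑ i, Z i := by
    ext ω; simp only [hZ, Finset.mul_sum, Finset.sum_apply]
  have hfac : ∀ i ω, Real.exp (t / α * Z i ω) =
      Real.exp (-(t / α * c * v i)) * Real.exp (t / α * c * (Y i ω) ^ 2) := by
    intro i ω
    rw [← Real.exp_add]
    congr 1
    simp only [hZ]
    ring
  set r : ι → ℝ := fun i => 2 * (c * v i) / α with hr
  have hr0 : ∀ i, 0 ≤ r i := fun i => by positivity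
  have hr1 : ∀ i, r i ≤ 1 := fun i => (div_le_one hα).2 (hv i)
  have htr : ∀ i, 2 * (t / α * c) * v i = t * r i := fun i => by simp only [hr]; ring
  have hlt : ∀ i, 2 * (t / α * c) * v i < 1 := fun i => by
    rw [htr]; exact mul_lt_one_of_lt_one_of_mem_unitInterval (hr0 i) (hr1 i) ht
  have hint : ∀ i, Integrable (fun ω => Real.exp (t / α * Z i ω)) P := by
    intro i
    simp only [hfac]
    refine Integrable.const_mul ?_ _
    have := integrable_exp_sq_gaussianReal (hlt i)
    rw [← hlaw i] at this
    exact this.comp_measurable (hY i)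
  have hmgf : ∀ i, mgf (Z i) P (t / α) ≤
      Real.exp (r i * ((-t - Real.log (1 - t)) / 2)) := by
    intro i
    refine le_trans (le_of_eq ?_) (exp_mul_inv_sqrt_le (hr0 i) (hr1 i) ht)
    simp only [mgf, hfac]
    rw [integral_const_mul, ← htr i, ← integral_exp_sq_gaussianReal (hlt i), ← hlaw i,
      integral_map (hY i).aemeasurable (by fun_prop)]
    congr 2
    ring
  have := hind.isProbabilityMeasure
  refine ⟨?_, ?_⟩
  · have := hZind.integrable_exp_mul_sum hZm (s := Finset.univ) (t := t / α) fun i _ => hint i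
    rwa [← hsum] at this
  · rw [hsum, hZind.mgf_sum hZm]
    refine (Finset.prod_le_prod (fun i _ => mgf_nonneg) fun i _ => hmgf i).trans ?_
    rw [← Real.exp_sum, ← Finset.sum_mul, Real.exp_le_exp]
    have hL : 0 ≤ -t - Real.log (1 - t) := by
      have := Real.log_le_sub_one_of_pos (show 0 < 1 - t by linarith)
      linarith
    have hrs : ∑ i, r i ≤ 2 * (β / α ^ 2) := by
      have : ∑ i, r i = 2 * (α * (c * ∑ i, (v i : ℝ)) / α ^ 2) := by
        simp only [hr, ← Finset.sum_div, ← Finset.mul_sum]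
        field_simp
      rw [this]
      gcongr
    calc _ ≤ 2 * (β / α ^ 2) * ((-t - Real.log (1 - t)) / 2) := by gcongr
      _ = _ := by ring

end IndependentGaussian

/-- The optimal value in Chernoff's bound for a centered gamma variable. -/
lemma chernoff_gamma_exponent {α β u : ℝ} (hα : 0 < α) (hβ : 0 < β) (hu : -1 < u) :
    Real.exp (-(u / (1 + u) / α) * (β * u / α)) *
      Real.exp (β / α ^ 2 * (-(u / (1 + u)) - Real.log (1 - u / (1 + u)))) =
    Real.exp (-(β * u / α) / α) * (1 + u) ^ (β / α ^ 2) := by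
  have h1 : 0 < 1 + u := by linarith
  have h2 : 1 - u / (1 + u) = (1 + u)⁻¹ := by field_simp; ring
  rw [Real.rpow_def_of_pos h1, ← Real.exp_add, ← Real.exp_add, h2, Real.log_inv]
  congr 1
  field_simp
  ring

open Matrix in
/-- Principal components: a centered Gaussian vector is, after an orthogonal change of
coordinates diagonalizing its covariance, a vector with independent centered Gaussian
coordinates. -/
lemma exists_independent_gaussian_coordinates {Ω ι : Type*} [MeasurableSpace Ω] [Fintype ι]
    {P : Measure Ω} [IsProbabilityMeasure P] {X : ι → Ω → ℝ} (hX : ∀ i, Measurable (X i))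
    (hG : ∀ c : ι → ℝ, ∃ v : NNReal, P.map (fun ω => ∑ i, c i * X i ω) = gaussianReal 0 v)
    {d : ι → ι → ℝ} (hd : ∀ k j, d k j = ∫ ω, X k ω * X j ω ∂P) :
    ∃ (Y : ι → Ω → ℝ) (v : ι → NNReal), (∀ i, Measurable (Y i)) ∧ iIndepFun Y P ∧
      (∀ i, P.map (Y i) = gaussianReal 0 (v i)) ∧
      (∀ ω, ∑ i, X i ω ^ 2 = ∑ i, Y i ω ^ 2) ∧
      (∀ ω, ∑ k, ∑ j, X k ω * X j ω * d k j = ∑ i, v i * Y i ω ^ 2) ∧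
      ∑ k, d k k = ∑ i, (v i : ℝ) := by
  classical
  have hsymm : (Matrix.of d).IsSymm := by
    ext i j
    simp only [transpose_apply, of_apply, hd, mul_comm]
  obtain ⟨U, l, hU, hU', hdiag⟩ := exists_orthogonal_diagonalization hsymm
  set Y : ι → Ω → ℝ := fun i ω => ∑ k, U k i * X k ω with hYdef
  have hYm : ∀ i, Measurable (Y i) := fun i => by simp only [hYdef]; fun_prop
  choose v hv using fun i => hG fun k => U k i
  have hXG : HasGaussianLaw (fun ω i => X i ω) P :=
    hasGaussianLaw_of_forall_sum_mul hX fun c => ⟨0, hG c⟩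
  have hYG : HasGaussianLaw (fun ω i => Y i ω) P := by
    refine hasGaussianLaw_of_forall_sum_mul hYm fun c => ⟨0, ?_⟩
    obtain ⟨w, hw⟩ := hG fun k => ∑ i, c i * U k i
    refine ⟨w, ?_⟩
    rw [← hw]
    congr 1
    ext ω
    simp only [hYdef, Finset.mul_sum, Finset.sum_mul]
    rw [Finset.sum_comm]
    simp only [mul_assoc]
  have hX2 : ∀ i, MemLp (X i) 2 P := fun i => (hXG.eval i).memLp_two
  have hY2 : ∀ i, MemLp (Y i) 2 P := fun i => (hYG.eval i).memLp_two
  have hmean : ∀ i, P[Y i] = 0 := by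
    intro i
    have : ∫ x, x ∂(P.map (Y i)) = 0 := by rw [hv i, integral_id_gaussianReal]
    rwa [integral_map (hYm i).aemeasurable (by fun_prop)] at this
  have hcov : ∀ i j, cov[Y i, Y j; P] = diagonal l i j := by
    intro i j
    rw [covariance_eq_sub (hY2 i) (hY2 j), hmean, zero_mul, sub_zero, ← hdiag]
    simp only [Pi.mul_apply, hYdef, Finset.sum_mul_sum]
    have hint : ∀ k m, Integrable (fun ω => U k i * X k ω * (U m j * X m ω)) P := fun k m =>
      ((hX2 k).const_mul (U k i)).integrable_mul ((hX2 m).const_mul (U m j))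
    rw [integral_finsetSum _ fun k _ => integrable_finsetSum _ fun m _ => hint k m]
    simp only [mul_apply, transpose_apply, of_apply, Finset.sum_mul]
    conv_rhs => rw [Finset.sum_comm]
    refine Finset.sum_congr rfl fun k _ => ?_
    rw [integral_finsetSum _ fun m _ => hint k m]
    refine Finset.sum_congr rfl fun m _ => ?_
    rw [hd, ← integral_const_mul, ← integral_mul_const]
    congr 1
    ext ω
    ring
  have hvl : ∀ i, (v i : ℝ) = l i := by
    intro i
    have h := hcov i i
    rw [covariance_self (hYm i).aemeasurable, diagonal_apply_eq] at h
    rw [← h, ← variance_id_gaussianReal (μ := 0) (v := v i), ← hv i,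
      variance_map (by fun_prop) (hYm i).aemeasurable]
    rfl
  have hYv : ∀ ω, (fun i => Y i ω) = Uᵀ *ᵥ fun k => X k ω := fun ω => by
    ext i; simp [hYdef, mulVec, dotProduct]
  refine ⟨Y, v, hYm, hYG.iIndepFun_of_covariance_eq_zero fun i j hij => by
    rw [hcov, diagonal_apply_ne _ hij], hv, fun ω => ?_, fun ω => ?_, ?_⟩
  · have : (fun i => Y i ω) ⬝ᵥ (fun i => Y i ω) = (fun k => X k ω) ⬝ᵥ fun k => X k ω := by
      rw [hYv, dotProduct_mulVec, vecMul_transpose, mulVec_mulVec, hU, one_mulVec]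
    simpa [dotProduct, sq] using this.symm
  · have hA : Matrix.of d = U * diagonal l * Uᵀ := by
      rw [← hdiag]
      calc _ = (U * Uᵀ) * Matrix.of d * (U * Uᵀ) := by rw [hU, one_mul, mul_one]
        _ = _ := by simp only [Matrix.mul_assoc]
    have : (fun k => X k ω) ⬝ᵥ (Matrix.of d *ᵥ fun k => X k ω) =
        (fun i => Y i ω) ⬝ᵥ (diagonal l *ᵥ fun i => Y i ω) := by
      rw [hA, hYv, ← mulVec_mulVec, ← mulVec_mulVec, dotProduct_mulVec, ← mulVec_transpose]
    simp only [dotProduct, mulVec_diagonal, ← hvl] at this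
    simp only [mulVec, dotProduct, of_apply, Finset.mul_sum] at this
    convert this using 2
    · exact Finset.sum_congr rfl fun _ _ => by ring
    · ring
  · have : trace (Matrix.of d) = trace (diagonal l) := by
      rw [← hdiag, trace_mul_comm, ← Matrix.mul_assoc, hU, one_mul]
    simpa [trace, ← hvl] using this

/-- Concentration inequality for quadratic forms of a centered jointly Gaussian
vector (Breton–Nourdin–Peccati / Breton–Coeurjolly). -/
theorem stmt_0
    {Ω : Type*} [MeasurableSpace Ω] (P : Measure Ω) [IsProbabilityMeasure P]
    {M : ℕ} (X : Fin M → Ω → ℝ)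
    (hmeas : ∀ i, Measurable (X i))
    (hGauss : ∀ c : Fin M → ℝ, ∃ v : NNReal,
      P.map (fun ω => ∑ i, c i * X i ω) = gaussianReal 0 v)
    (d : Fin M → Fin M → ℝ)
    (hd : ∀ k j, d k j = ∫ ω, X k ω * X j ω ∂P)
    (c : ℝ) (Q1 Q2 : Ω → ℝ)
    (hQ1 : Q1 = fun ω => c * ∑ k, ((X k ω) ^ 2 - d k k))
    (hQ2 : Q2 = fun ω => 2 * c ^ 2 * ∑ k, ∑ j, X k ω * X j ω * d k j)
    (hQ1ne : ¬ (∀ᵐ ω ∂P, Q1 ω = 0))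
    (α β : ℝ) (hα : 0 ≤ α) (hβ : 0 < β)
    (hQ : ∀ᵐ ω ∂P, Q2 ω ≤ α * Q1 ω + β) :
    ∀ z > 0,
      P {ω | z ≤ Q1 ω} ≤
        ENNReal.ofReal (Real.exp (-z / α) * (1 + α * z / β) ^ (β / α ^ 2)) ∧
      P {ω | Q1 ω ≤ -z} ≤
        ENNReal.ofReal (Real.exp (z / α) * (1 - α * z / β) ^ (β / α ^ 2) *
          Set.indicator (Set.Icc 0 (β / α)) (fun _ => (1 : ℝ)) z) := by
  obtain ⟨Y, v, hYm, hind, hlaw, hsq, hquad, htr⟩ :=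
    exists_independent_gaussian_coordinates hmeas hGauss hd
  have hQ1' : Q1 = fun ω => c * ∑ i, (Y i ω ^ 2 - v i) := by
    simp only [hQ1, Finset.sum_sub_distrib, hsq, htr]
  have hc : c ≠ 0 := by
    rintro rfl
    exact hQ1ne (ae_of_all _ fun ω => by simp [hQ1])
  obtain ⟨j, hj⟩ : ∃ j, v j ≠ 0 := by
    by_contra! h
    refine hQ1ne ?_
    have : ∀ i, ∀ᵐ ω ∂P, Y i ω = 0 := by
      intro i
      refine ae_of_ae_map (p := fun x => x = 0) (hYm i).aemeasurable ?_
      rw [hlaw, h, gaussianReal_zero_var, ae_dirac_eq]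
      rfl
    filter_upwards [ae_all_iff.2 this] with ω hω
    simp [hQ1', h, hω]
  set F : (Fin M → ℝ) → ℝ := fun y =>
    2 * c ^ 2 * ∑ i, v i * y i ^ 2 - α * (c * ∑ i, (y i ^ 2 - v i)) with hF
  have hFc : Continuous F := by fun_prop
  have hFβ : ∀ᵐ ω ∂P, F (fun i => Y i ω) ≤ β := by
    filter_upwards [hQ] with ω hω
    simp only [hQ1', hQ2, hquad] at hω
    simp only [hF]
    linarith
  have hsupp : ∀ y : Fin M → ℝ, (∀ i, v i = 0 → y i = 0) → F y ≤ β := fun y hy =>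
    le_of_ae_le_comp hYm hind hlaw hFc hFβ hy
  have htrβ : α * (c * ∑ i, (v i : ℝ)) ≤ β := by
    have := hsupp 0 fun _ _ => rfl
    simpa [hF] using this
  have hvar : ∀ i, v i ≠ 0 → 2 * c ^ 2 * v i ≤ α * c := by
    intro i hi
    by_contra! hlt
    have hline : ∀ x : ℝ, (2 * c ^ 2 * v i - α * c) * x ^ 2 ≤ β - α * (c * ∑ i, (v i : ℝ)) := by
      intro x
      have := hsupp (Pi.single i x) fun k hk => by
        rw [Pi.single_eq_of_ne]; rintro rfl; exact hi hk
      simp only [hF, Finset.sum_sub_distrib] at this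
      have h1 : ∑ k, (Pi.single i x : Fin M → ℝ) k ^ 2 = x ^ 2 := by
        rw [Finset.sum_eq_single i] <;> simp +contextual
      have h2 : ∑ k, v k * (Pi.single i x : Fin M → ℝ) k ^ 2 = v i * x ^ 2 := by
        rw [Finset.sum_eq_single i] <;> simp +contextual
      rw [h1, h2] at this
      linarith
    set a := 2 * c ^ 2 * v i - α * c
    set b := β - α * (c * ∑ i, (v i : ℝ))
    have ha : 0 < a := sub_pos.2 hlt
    have hb : 0 ≤ b := by simpa using hline 0
    have := hline (√((b + 1) / a))
    rw [Real.sq_sqrt (by positivity), mul_div_cancel₀ _ ha.ne'] at this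
    linarith
  have hαc : 0 < α * c := lt_of_lt_of_le (by positivity) (hvar j hj)
  have hα0 : 0 < α := hα.lt_of_ne (by rintro rfl; simp at hαc)
  have hc0 : 0 < c := pos_of_mul_pos_right hαc hα
  have hvα : ∀ i, 2 * (c * v i) ≤ α := by
    intro i
    by_cases hi : v i = 0
    · simpa [hi] using hα
    · exact le_of_mul_le_mul_right (by linarith [hvar i hi]) hc0
  have hlap : ∀ t < 1, Integrable (fun ω => Real.exp (t / α * Q1 ω)) P ∧
      mgf Q1 P (t / α) ≤ Real.exp (β / α ^ 2 * (-t - Real.log (1 - t))) := by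
    intro t ht
    rw [hQ1']
    exact mgf_sum_sq_sub_le hYm hind hlaw hα0 hc0.le hvα htrβ ht
  have hlow : ∀ ω, -(β / α) ≤ Q1 ω := by
    intro ω
    have h1 : c * ∑ i, (v i : ℝ) ≤ β / α := by rw [le_div_iff₀ hα0]; linarith
    have h2 : 0 ≤ c * ∑ i, Y i ω ^ 2 := by positivity
    simp only [hQ1', Finset.sum_sub_distrib]
    linarith
  have hleft : ∀ z, 0 ≤ z → z < β / α → P.real {ω | Q1 ω ≤ -z} ≤
      Real.exp (z / α) * (1 - α * z / β) ^ (β / α ^ 2) := by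
    intro z hz hzβ
    set u := -(α * z / β) with hu
    have hu1 : -1 < u := by
      rw [hu, neg_lt_neg_iff, div_lt_one hβ, mul_comm]
      exact (lt_div_iff₀ hα0).1 hzβ
    have hu0 : u ≤ 0 := neg_nonpos.2 (by positivity)
    have hz' : -z = β * u / α := by rw [hu]; field_simp
    have ht0 : u / (1 + u) ≤ 0 := div_nonpos_of_nonpos_of_nonneg hu0 (by linarith)
    have ht := hlap (u / (1 + u)) (by linarith)
    have := measure_le_le_exp_mul_mgf (-z) (div_nonpos_of_nonpos_of_nonneg ht0 hα) ht.1
    refine (this.trans (mul_le_mul_of_nonneg_left ht.2 (Real.exp_nonneg _))).trans_eq ?_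
    rw [hz', chernoff_gamma_exponent hα0 hβ hu1, ← hz', neg_neg, hu, ← sub_eq_add_neg]
  intro z hz
  constructor
  · rw [← ofReal_measureReal]
    refine ENNReal.ofReal_le_ofReal ?_
    set u := α * z / β with hu
    have hu0 : 0 < u := by positivity
    have hz' : z = β * u / α := by rw [hu]; field_simp
    have ht := hlap (u / (1 + u)) ((div_lt_one (by linarith)).2 (by linarith))
    have := measure_ge_le_exp_mul_mgf z (by positivity) ht.1
    refine (this.trans (mul_le_mul_of_nonneg_left ht.2 (Real.exp_nonneg _))).trans_eq ?_
    conv_lhs => rw [hz', chernoff_gamma_exponent hα0 hβ (by linarith), ← hz']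
  · rw [← ofReal_measureReal]
    refine ENNReal.ofReal_le_ofReal ?_
    rcases lt_trichotomy z (β / α) with hlt | heq | hgt
    · rw [Set.indicator_of_mem (Set.mem_Icc.2 ⟨hz.le, hlt.le⟩), mul_one]
      exact hleft z hz.le hlt
    · rw [Set.indicator_of_mem (Set.mem_Icc.2 ⟨hz.le, heq.le⟩), mul_one]
      have hcont : ContinuousWithinAt
          (fun x => Real.exp (x / α) * (1 - α * x / β) ^ (β / α ^ 2)) (Set.Iio z) z :=
        ((by fun_prop : Continuous fun x : ℝ => Real.exp (x / α)).mul
          ((by fun_prop : Continuous fun x : ℝ => 1 - α * x / β).rpow_const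
            fun _ => Or.inr (by positivity))).continuousWithinAt
      refine ge_of_tendsto hcont ?_
      filter_upwards [Ioo_mem_nhdsLT hz] with x hx
      refine le_trans (measureReal_mono fun ω hω => ?_) (hleft x hx.1.le (heq ▸ hx.2))
      exact le_trans hω (neg_le_neg hx.2.le)
    · rw [Set.indicator_of_notMem fun h => hgt.not_ge h.2, mul_zero]
      have : {ω | Q1 ω ≤ -z} = ∅ := by
        ext ω
        simp only [Set.mem_ofPred_eq, Set.mem_empty_iff_false, iff_false, not_le]
        linarith [hlow ω]
      simp [this]
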